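/- Let p ≥ 2 and d ≥ 1 be integers, let ω ∈ ℝ^d have all components ω_i > 0, let φ : ℕ^d → ℂ satisfy φ_n ≠ 0 only if 1 ≤ n, and let c ∈ 𝒳 satisfy the recursion (FF). For each n ∈ ℕ^d define a_n : ℝ → ℂ by a_n(t) = Σ_{n ≤ j ≤ n²} c_{n,j} e^{i (ω²·j) t}. Then for every n ∈ ℕ^d: a_n(0) = φ_n, each a_n is differentiable, and a_n'(t) = i (ω²·n²) a_n(t) − i Σ_{n₁+⋯+n_p = n} a_{n₁}(t) a_{n₂}(t) ⋯ a_{n_p}(t) for all t ∈ ℝ (the sum over all p-tuples (n₁,…,n_p) ∈ (ℕ^d)^p with n₁+⋯+n_p = n is finite). In other words, the Fourier polynomials built from the recursion solve the Fourier-mode system of the NLS i u_t = Δu + u^p. -/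

import Mathlib

open scoped BigOperators

noncomputable section

/-- Cauchy product of doubly-indexed sequences:
`(a*b)_{n,j} = ∑_{n₁+n₂=n} ∑_{j₁+j₂=j} a_{n₁,j₁} b_{n₂,j₂}`. -/
def conv2 {d : ℕ} (a b : (Fin d → ℕ) → (Fin d → ℕ) → ℂ) :
    (Fin d → ℕ) → (Fin d → ℕ) → ℂ :=
  fun n j => ∑ k ∈ Finset.Icc 0 n, ∑ l ∈ Finset.Icc 0 j, a k l * b (n - k) (j - l)

/-- `cpow2 a p` is the `p`-fold Cauchy product `a^p`
(with `a^0` the convolution identity). -/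
def cpow2 {d : ℕ} (a : (Fin d → ℕ) → (Fin d → ℕ) → ℂ) :
    ℕ → (Fin d → ℕ) → (Fin d → ℕ) → ℂ
  | 0 => fun n j => if n = 0 ∧ j = 0 then 1 else 0
  | (k + 1) => conv2 a (cpow2 a k)

/-- Membership in `𝒳`: `c_{n,j} ≠ 0` only if `1 ≤ n` and `n ≤ j ≤ n²`
(all componentwise). -/
def memX {d : ℕ} (c : (Fin d → ℕ) → (Fin d → ℕ) → ℂ) : Prop :=
  ∀ n j, c n j ≠ 0 → (1 : Fin d → ℕ) ≤ n ∧ n ≤ j ∧ j ≤ n * n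

/-- `ω²·m = ∑ᵢ ωᵢ² mᵢ`. -/
def wdot {d : ℕ} (ω : Fin d → ℝ) (m : Fin d → ℕ) : ℝ :=
  ∑ i, (ω i) ^ 2 * (m i : ℝ)

/-- The recursion (FF): for every `n` with `1 ≤ n`,
`c_{n,j} = (c^p)_{n,j} / (ω²·(n²−j))` for `n ≤ j ≤ n²`, `j ≠ n²`, and
`c_{n,n²} = φ_n − ∑_{n ≤ k ≤ n², k ≠ n²} (c^p)_{n,k} / (ω²·(n²−k))`. -/
def FF {d : ℕ} (p : ℕ) (ω : Fin d → ℝ) (φ : (Fin d → ℕ) → ℂ)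
    (c : (Fin d → ℕ) → (Fin d → ℕ) → ℂ) : Prop :=
  ∀ n : Fin d → ℕ, (1 : Fin d → ℕ) ≤ n →
    (∀ j, n ≤ j → j ≤ n * n → j ≠ n * n →
      c n j = cpow2 c p n j / ((wdot ω (n * n - j) : ℝ) : ℂ)) ∧
    c n (n * n) = φ n - ∑ k ∈ (Finset.Icc n (n * n)).erase (n * n),
      cpow2 c p n k / ((wdot ω (n * n - k) : ℝ) : ℂ)

theorem wdot_add {d : ℕ} (ω : Fin d → ℝ) (m n : Fin d → ℕ) :
    wdot ω (m + n) = wdot ω m + wdot ω n := by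
  unfold wdot
  rw [← Finset.sum_add_distrib]
  refine Finset.sum_congr rfl fun i _ => ?_
  simp only [Pi.add_apply, Nat.cast_add]
  ring

theorem wdot_sub {d : ℕ} (ω : Fin d → ℝ) (m n : Fin d → ℕ) (h : n ≤ m) :
    wdot ω (m - n) = wdot ω m - wdot ω n := by
  have := wdot_add ω (m - n) n
  rw [tsub_add_cancel_of_le h] at this
  linarith

theorem wdot_ne {d : ℕ} (ω : Fin d → ℝ) (hω : ∀ i, 0 < ω i) (m : Fin d → ℕ) (h : m ≠ 0) :
    wdot ω m ≠ 0 := by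
  obtain ⟨i, hi⟩ := Function.ne_iff.mp h
  have hi' : 0 < m i := Nat.pos_of_ne_zero hi
  apply ne_of_gt
  unfold wdot
  refine Finset.sum_pos' (fun j _ => by positivity) ⟨i, Finset.mem_univ _, ?_⟩
  have := hω i
  positivity

theorem conv2_ne {d : ℕ} {a b : (Fin d → ℕ) → (Fin d → ℕ) → ℂ} {n j : Fin d → ℕ}
    (h : conv2 a b n j ≠ 0) : ∃ n₁ n₂ j₁ j₂, n = n₁ + n₂ ∧ j = j₁ + j₂ ∧
      a n₁ j₁ ≠ 0 ∧ b n₂ j₂ ≠ 0 := by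
  unfold conv2 at h
  obtain ⟨k, hk, h⟩ := Finset.exists_ne_zero_of_sum_ne_zero h
  obtain ⟨l, hl, h⟩ := Finset.exists_ne_zero_of_sum_ne_zero h
  rw [Finset.mem_Icc] at hk hl
  exact ⟨k, n - k, l, j - l, (add_tsub_cancel_of_le hk.2).symm,
    (add_tsub_cancel_of_le hl.2).symm, left_ne_zero_of_mul h, right_ne_zero_of_mul h⟩

theorem cpow2_supp {d : ℕ} {c : (Fin d → ℕ) → (Fin d → ℕ) → ℂ} (hc : memX c) (k : ℕ) :
    ∀ n j, cpow2 c k n j ≠ 0 → (k ≠ 0 → (1 : Fin d → ℕ) ≤ n) ∧ n ≤ j ∧ j ≤ n * n := by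
  induction k with
  | zero =>
    intro n j h
    simp only [cpow2, ne_eq, ite_eq_right_iff, not_forall] at h
    obtain ⟨⟨rfl, rfl⟩, -⟩ := h
    simp
  | succ k ih =>
    intro n j h
    obtain ⟨n₁, n₂, j₁, j₂, rfl, rfl, h1, h2⟩ := conv2_ne (show conv2 c (cpow2 c k) n j ≠ 0 from h)
    obtain ⟨a1, a2, a3⟩ := hc _ _ h1
    obtain ⟨-, b2, b3⟩ := ih _ _ h2
    refine ⟨fun _ => le_add_right a1, add_le_add a2 b2, fun i => ?_⟩
    have := a3 i
    have := b3 i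
    simp only [Pi.add_apply, Pi.mul_apply] at *
    nlinarith [Nat.zero_le (n₁ i * n₂ i)]

theorem cpow2_top {d : ℕ} (hd : 1 ≤ d) {c : (Fin d → ℕ) → (Fin d → ℕ) → ℂ} (hc : memX c)
    (p : ℕ) (hp : 2 ≤ p) (n : Fin d → ℕ) : cpow2 c p n (n * n) = 0 := by
  obtain ⟨k, rfl⟩ : ∃ k, p = k + 1 := ⟨p - 1, by omega⟩
  by_contra h
  obtain ⟨n₁, n₂, j₁, j₂, hn, hj, h1, h2⟩ :=
    conv2_ne (show conv2 c (cpow2 c k) n (n * n) ≠ 0 from h)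
  obtain ⟨a1, a2, a3⟩ := hc _ _ h1
  obtain ⟨b1, b2, b3⟩ := cpow2_supp hc k _ _ h2
  have b1 := b1 (by omega)
  have e1 := a1 ⟨0, hd⟩
  have e2 := b1 ⟨0, hd⟩
  have e3 := a3 ⟨0, hd⟩
  have e4 := b3 ⟨0, hd⟩
  have e5 := congrFun hj ⟨0, hd⟩
  subst hn
  simp only [Pi.add_apply, Pi.mul_apply, Pi.one_apply] at *
  nlinarith [Nat.mul_le_mul e1 e2]

/-- Sum over `p`-tuples of indices with total `n`. -/
def tupSum {d : ℕ} (b : (Fin d → ℕ) → ℂ) (p : ℕ) (n : Fin d → ℕ) : ℂ :=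
  ∑ f ∈ (Fintype.piFinset fun _ : Fin p => Finset.Icc 0 n).filter
    (fun f => (∑ i, f i) = n), ∏ i, b (f i)

theorem tupSum_zero {d : ℕ} (b : (Fin d → ℕ) → ℂ) (n : Fin d → ℕ) :
    tupSum b 0 n = if n = 0 then 1 else 0 := by
  unfold tupSum
  by_cases h : n = 0
  · subst h
    simp
  · simp [h, Ne.symm h]

theorem tupSum_succ {d : ℕ} (b : (Fin d → ℕ) → ℂ) (p : ℕ) (n : Fin d → ℕ) :
    tupSum b (p + 1) n = ∑ m ∈ Finset.Icc 0 n, b m * tupSum b p (n - m) := by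
  unfold tupSum
  simp only [Finset.mul_sum]
  rw [Finset.sum_sigma']
  refine Finset.sum_bij' (fun f _ => ⟨f 0, Fin.tail f⟩) (fun x _ => Fin.cons x.1 x.2) ?_ ?_ ?_ ?_ ?_
  · intro f hf
    simp only [Finset.mem_filter, Fintype.mem_piFinset, Finset.mem_Icc, Fin.sum_univ_succ,
      Finset.mem_sigma] at hf ⊢
    obtain ⟨h1, h2⟩ := hf
    have h3 : ∑ i, Fin.tail f i = n - f 0 := by
      rw [← h2, add_tsub_cancel_left]; rfl
    refine ⟨h1 0, fun i => ⟨zero_le, ?_⟩, h3⟩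
    rw [← h3]
    exact Finset.single_le_sum (f := Fin.tail f) (fun _ _ => zero_le) (Finset.mem_univ i)
  · rintro ⟨m, g⟩ hx
    simp only [Finset.mem_filter, Fintype.mem_piFinset, Finset.mem_Icc, Fin.sum_univ_succ,
      Finset.mem_sigma, Fin.cons_zero, Fin.cons_succ] at hx ⊢
    obtain ⟨h1, h2, h3⟩ := hx
    refine ⟨fun i => ⟨zero_le, ?_⟩, by rw [h3, add_tsub_cancel_of_le h1.2]⟩
    refine Fin.cases ?_ (fun i => ?_) i
    · simpa using h1.2
    · simpa using (h2 i).2.trans tsub_le_self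
  · intro f _
    simp
  · rintro ⟨m, g⟩ _
    simp
  · intro f _
    rw [Fin.prod_univ_succ]
    rfl

theorem sum_box {d : ℕ} (g : (Fin d → ℕ) → ℂ) (n M N : Fin d → ℕ) (hMN : M ≤ N)
    (hg : ∀ j, g j ≠ 0 → n ≤ j ∧ j ≤ M) :
    ∑ j ∈ Finset.Icc n M, g j = ∑ j ∈ Finset.Icc 0 N, g j := by
  refine Finset.sum_subset (Finset.Icc_subset_Icc zero_le hMN) fun j _ hj => ?_
  by_contra h
  exact hj (Finset.mem_Icc.mpr (hg j h))

theorem box_mul {d : ℕ} (x y : (Fin d → ℕ) → ℂ) (M₁ M₂ N : Fin d → ℕ) (hN : M₁ + M₂ ≤ N)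
    (hx : ∀ j, x j ≠ 0 → j ≤ M₁) (hy : ∀ j, y j ≠ 0 → j ≤ M₂) :
    (∑ l ∈ Finset.Icc 0 M₁, x l) * (∑ r ∈ Finset.Icc 0 M₂, y r) =
      ∑ j ∈ Finset.Icc 0 N, ∑ l ∈ Finset.Icc 0 j, x l * y (j - l) := by
  rw [Finset.sum_mul_sum, ← Finset.sum_product']
  rw [← Finset.sum_fiberwise_of_maps_to (t := Finset.Icc 0 N) (g := fun q => q.1 + q.2)]
  · refine Finset.sum_congr rfl fun j _ => ?_
    refine Finset.sum_of_injOn (fun q => q.1) ?_ ?_ ?_ ?_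
    · rintro ⟨l, r⟩ h ⟨l', r'⟩ h' hh
      simp only [Finset.coe_filter, Set.mem_ofPred_eq] at h h' hh
      subst hh
      have : r = r' := add_left_cancel (h.2.trans h'.2.symm)
      rw [this]
    · rintro ⟨l, r⟩ h
      simp only [Finset.coe_filter, Set.mem_ofPred_eq] at h
      simp only [Finset.coe_Icc, Set.mem_Icc]
      exact ⟨zero_le, h.2 ▸ le_self_add⟩
    · intro l hl hl'
      by_contra h
      apply hl'
      rw [Finset.mem_Icc] at hl
      refine ⟨(l, j - l), ?_, rfl⟩
      simp only [Finset.coe_filter, Set.mem_ofPred_eq, Finset.mem_product, Finset.mem_Icc]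
      exact ⟨⟨⟨zero_le, hx _ (left_ne_zero_of_mul h)⟩, zero_le, hy _ (right_ne_zero_of_mul h)⟩,
        add_tsub_cancel_of_le hl.2⟩
    · rintro ⟨l, r⟩ h
      rw [Finset.mem_filter] at h
      rw [← h.2]
      simp
  · rintro ⟨l, r⟩ h
    simp only [Finset.mem_product, Finset.mem_Icc] at h ⊢
    exact ⟨zero_le, (add_le_add h.1.2 h.2.2).trans hN⟩

theorem tupSum_eq {d : ℕ} {c : (Fin d → ℕ) → (Fin d → ℕ) → ℂ} (hc : memX c)
    (E : (Fin d → ℕ) → ℂ) (hE0 : E 0 = 1) (hE : ∀ i j, E (i + j) = E i * E j) (k : ℕ) :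
    ∀ n, tupSum (fun n => ∑ j ∈ Finset.Icc n (n * n), c n j * E j) k n =
      ∑ j ∈ Finset.Icc n (n * n), cpow2 c k n j * E j := by
  induction k with
  | zero =>
    intro n
    rw [tupSum_zero]
    by_cases h : n = 0
    · subst h
      simp [cpow2, hE0]
    · simp [cpow2, h]
  | succ k ih =>
    intro n
    rw [tupSum_succ, sum_box _ n (n * n) (n * n) le_rfl
      (fun j hj => (cpow2_supp hc (k + 1) n j (left_ne_zero_of_mul hj)).2)]
    have : ∀ j, cpow2 c (k + 1) n j * E j = ∑ m ∈ Finset.Icc 0 n, ∑ l ∈ Finset.Icc 0 j,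
        (c m l * E l) * (cpow2 c k (n - m) (j - l) * E (j - l)) := by
      intro j
      simp only [cpow2, conv2, Finset.sum_mul]
      refine Finset.sum_congr rfl fun m _ => Finset.sum_congr rfl fun l hl => ?_
      rw [Finset.mem_Icc] at hl
      have := hE l (j - l)
      rw [add_tsub_cancel_of_le hl.2] at this
      rw [this]
      ring
    simp only [this]
    rw [Finset.sum_comm]
    refine Finset.sum_congr rfl fun m hm => ?_
    rw [Finset.mem_Icc] at hm
    rw [ih, sum_box _ m (m * m) (m * m) le_rfl
      (fun j hj => (hc m j (left_ne_zero_of_mul hj)).2), sum_box _ (n - m) _ _ le_rfl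
      (fun j hj => (cpow2_supp hc k (n - m) j (left_ne_zero_of_mul hj)).2)]
    refine box_mul (fun l => c m l * E l) (fun r => cpow2 c k (n - m) r * E r) _ _ _ ?_
      (fun j hj => (hc m j (left_ne_zero_of_mul hj)).2.2)
      (fun j hj => (cpow2_supp hc k (n - m) j (left_ne_zero_of_mul hj)).2.2)
    obtain ⟨r, rfl⟩ := exists_add_of_le hm.2
    rw [add_tsub_cancel_left]
    intro i
    simp only [Pi.add_apply, Pi.mul_apply]
    nlinarith [Nat.zero_le (m i * r i)]

/-- The Fourier polynomials `a_n(t) = ∑_{n ≤ j ≤ n²} c_{n,j} e^{i(ω²·j)t}` built from the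
recursion (FF) solve the Fourier-mode system of the NLS `i u_t = Δu + u^p`:
`a_n(0) = φ_n` and `a_n'(t) = i(ω²·n²) a_n(t) − i ∑_{n₁+⋯+n_p=n} a_{n₁}(t)⋯a_{n_p}(t)`. -/
theorem stmt4 (p d : ℕ) (hp : 2 ≤ p) (hd : 1 ≤ d)
    (ω : Fin d → ℝ) (hω : ∀ i, 0 < ω i)
    (φ : (Fin d → ℕ) → ℂ) (hφ : ∀ n, φ n ≠ 0 → (1 : Fin d → ℕ) ≤ n)
    (c : (Fin d → ℕ) → (Fin d → ℕ) → ℂ) (hcX : memX c) (hcFF : FF p ω φ c)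
    (a : (Fin d → ℕ) → ℝ → ℂ)
    (ha : ∀ n t, a n t = ∑ j ∈ Finset.Icc n (n * n),
      c n j * Complex.exp (Complex.I * ((wdot ω j : ℝ) : ℂ) * (t : ℂ))) :
    ∀ n : Fin d → ℕ,
      a n 0 = φ n ∧
      ∀ t : ℝ, HasDerivAt (a n)
        (Complex.I * ((wdot ω (n * n) : ℝ) : ℂ) * a n t -
          Complex.I * ∑ f ∈ (Fintype.piFinset fun _ : Fin p => Finset.Icc 0 n).filter
              (fun f => (∑ i, f i) = n),
            ∏ i, a (f i) t) t := by
  intro n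
  have hkey : ∀ j ∈ Finset.Icc n (n * n), c n j * ((wdot ω (n * n) : ℝ) - (wdot ω j : ℝ) : ℂ)
      = cpow2 c p n j := by
    intro j hj
    rw [Finset.mem_Icc] at hj
    by_cases hjn : j = n * n
    · rw [hjn, cpow2_top hd hcX p hp]
      simp
    by_cases hn : (1 : Fin d → ℕ) ≤ n
    · have hne : ((wdot ω (n * n - j) : ℝ) : ℂ) ≠ 0 := by
        rw [Complex.ofReal_ne_zero]
        refine wdot_ne ω hω _ fun h => hjn (le_antisymm hj.2 (tsub_eq_zero_iff_le.mp h))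
      rw [← Complex.ofReal_sub, ← wdot_sub ω _ _ hj.2, (hcFF n hn).1 j hj.1 hj.2 hjn,
        div_mul_cancel₀ _ hne]
    · have h1 : c n j = 0 := by
        by_contra h
        exact hn (hcX n j h).1
      have h2 : cpow2 c p n j = 0 := by
        by_contra h
        exact hn ((cpow2_supp hcX p n j h).1 (by omega))
      rw [h1, h2, zero_mul]
  refine ⟨?_, fun t => ?_⟩
  · rw [ha]
    simp only [Complex.ofReal_zero, mul_zero, Complex.exp_zero, mul_one]
    by_cases hn : (1 : Fin d → ℕ) ≤ n
    · have hmem : n * n ∈ Finset.Icc n (n * n) := by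
        rw [Finset.mem_Icc]
        exact ⟨fun i => Nat.le_mul_of_pos_left _ (hn i), le_rfl⟩
      rw [← Finset.add_sum_erase _ _ hmem, (hcFF n hn).2, sub_add_eq_add_sub, add_sub_assoc,
        ← Finset.sum_sub_distrib, Finset.sum_eq_zero, add_zero]
      intro j hj
      rw [Finset.mem_erase, Finset.mem_Icc] at hj
      rw [(hcFF n hn).1 j hj.2.1 hj.2.2 hj.1, sub_self]
    · have : φ n = 0 := by
        by_contra h
        exact hn (hφ n h)
      rw [this]
      refine Finset.sum_eq_zero fun j _ => ?_
      by_contra h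
      exact hn (hcX n j h).1
  · have hT := tupSum_eq hcX
      (fun j => Complex.exp (Complex.I * ((wdot ω j : ℝ) : ℂ) * (t : ℂ)))
      (by simp [wdot]) (by
        intro i j
        rw [← Complex.exp_add, wdot_add]
        congr 1
        push_cast
        ring) p n
    have hT' : ∑ f ∈ (Fintype.piFinset fun _ : Fin p => Finset.Icc 0 n).filter
        (fun f => (∑ i, f i) = n), ∏ i, a (f i) t = ∑ j ∈ Finset.Icc n (n * n),
          cpow2 c p n j * Complex.exp (Complex.I * ((wdot ω j : ℝ) : ℂ) * (t : ℂ)) := by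
      rw [← hT]
      unfold tupSum
      simp only [ha]
    rw [hT', ha, Finset.mul_sum, Finset.mul_sum, ← Finset.sum_sub_distrib]
    have hfun : a n = fun t : ℝ => ∑ j ∈ Finset.Icc n (n * n),
      c n j * Complex.exp (Complex.I * ((wdot ω j : ℝ) : ℂ) * (t : ℂ)) := funext (ha n)
    rw [hfun]
    refine HasDerivAt.fun_sum fun j hj => ?_
    have h1 : HasDerivAt (fun t : ℝ => Complex.I * ((wdot ω j : ℝ) : ℂ) * (t : ℂ))
        (Complex.I * ((wdot ω j : ℝ) : ℂ) * 1) t :=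
      (Complex.ofRealCLM.hasDerivAt (x := t)).const_mul _
    have h2 := (h1.cexp).const_mul (c n j)
    refine HasDerivAt.congr_deriv h2 ?_
    rw [← hkey j hj]
    ring
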